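/- Let h = 2n+1 be an odd integer with n ≥ 1 and let τ be an h-bar-core. Then the set P_{τ,1} of h-strict partitions with h-bar-core τ and h-bar-weight 1 contains exactly n+1 partitions; these n+1 partitions are totally ordered by the dominance order ⊴, and every partition in P_{τ,1} except the most dominant one is restricted (while the most dominant one is not restricted). -/

import Mathlib

/-- A partition: a weakly decreasing sequence of non-negative integers with
finite sum (finitely many nonzero parts), indexed from 0 (so `parts 0` is λ₁). -/
structure BPartition where
  parts : ℕ →₀ ℕ
  antitone : ∀ r, parts (r + 1) ≤ parts r

namespace BPartition

/-- The multiset of positive parts of a partition. -/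
def partsM (lam : BPartition) : Multiset ℕ :=
  lam.parts.support.val.map (fun r => lam.parts r)

/-- The Young diagram: nodes `(r, c)` with rows indexed from 0 and columns from 1. -/
def diagram (lam : BPartition) : Set (ℕ × ℕ) :=
  {x | 1 ≤ x.2 ∧ x.2 ≤ lam.parts x.1}

/-- A partition is strict if λ_r > λ_{r+1} whenever λ_r > 0. -/
def IsStrict (lam : BPartition) : Prop :=
  ∀ r, 0 < lam.parts r → lam.parts (r + 1) < lam.parts r

/-- A partition is h-strict if each part is either strictly bigger than the next,
or positive and divisible by h, or zero. -/
def IsHStrict (h : ℕ) (lam : BPartition) : Prop :=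
  ∀ r, lam.parts (r + 1) < lam.parts r ∨ (0 < lam.parts r ∧ h ∣ lam.parts r) ∨ lam.parts r = 0

/-- An h-strict partition is restricted if for every r either λ_{r+1} > λ_r − h,
or λ_{r+1} = λ_r − h and h does not divide λ_r. -/
def IsRestricted (h : ℕ) (lam : BPartition) : Prop :=
  ∀ r, lam.parts r < lam.parts (r + 1) + h ∨
    (lam.parts (r + 1) + h = lam.parts r ∧ ¬ h ∣ lam.parts r)

/-- The residue of a node in column c (1-indexed): the smaller of the residues of
c − 1 and of −c modulo h. -/
def colRes (h c : ℕ) : ℕ := min ((c - 1) % h) ((h - c % h) % h)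

/-- `x` is an addable i-node of `lam`. -/
def Addable (h i : ℕ) (lam : BPartition) (x : ℕ × ℕ) : Prop :=
  colRes h x.2 = i ∧ x ∉ diagram lam ∧
  ∃ nu : BPartition, IsHStrict h nu ∧ diagram lam ⊆ diagram nu ∧ x ∈ diagram nu ∧
    ∀ y ∈ diagram nu, y ∉ diagram lam → colRes h y.2 = i

/-- `x` is a removable i-node of `lam`. -/
def Removable (h i : ℕ) (lam : BPartition) (x : ℕ × ℕ) : Prop :=
  x ∈ diagram lam ∧
  ∃ mu : BPartition, IsHStrict h mu ∧ diagram mu ⊆ diagram lam ∧ x ∉ diagram mu ∧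
    ∀ y ∈ diagram lam, y ∉ diagram mu → colRes h y.2 = i

/-- Removal of a single h-bar from `lam` giving `mu`, recording the value `v`:
either a part `v ≥ h` is replaced by `v − h` (deleted if `v = h`), or two parts
summing to `h` are deleted, in which case `v` is the larger of the two. -/
def barStepRec (h : ℕ) (lam mu : BPartition) (v : ℕ) : Prop :=
  IsHStrict h mu ∧
  ((v = h ∧ v ∈ partsM lam ∧ partsM mu = (partsM lam).erase v) ∨
   (h < v ∧ v ∈ partsM lam ∧ partsM mu = (v - h) ::ₘ (partsM lam).erase v) ∨
   (∃ a b : ℕ, a + b = h ∧ a ∈ partsM lam ∧ b ∈ (partsM lam).erase a ∧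
      v = max a b ∧ partsM mu = ((partsM lam).erase a).erase b))

/-- Removal of a single h-bar. -/
def barStep (h : ℕ) (lam mu : BPartition) : Prop :=
  ∃ v, barStepRec h lam mu v

/-- An h-bar-core: an h-strict partition from which no h-bar can be removed. -/
def IsBarCore (h : ℕ) (lam : BPartition) : Prop :=
  IsHStrict h lam ∧ ∀ mu, ¬ barStep h lam mu

/-- A chain of `w` h-bar removals from `lam` down to `mu`. -/
def barChain (h : ℕ) : ℕ → BPartition → BPartition → Prop
  | 0, lam, mu => lam = mu
  | w + 1, lam, mu => ∃ nu, barStep h lam nu ∧ barChain h w nu mu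

/-- `lam ∈ P_{τ,w}`: `lam` is h-strict with h-bar-core `tau` and h-bar-weight `w`. -/
def InBlock (h : ℕ) (tau : BPartition) (w : ℕ) (lam : BPartition) : Prop :=
  IsHStrict h lam ∧ IsBarCore h tau ∧ barChain h w lam tau

/-- The left-to-right order on node positions along the edge of a Young diagram:
smaller column first; within a column, larger row first. -/
def posLE (x y : ℕ × ℕ) : Prop := x.2 < y.2 ∨ (x.2 = y.2 ∧ y.1 ≤ x.1)

/-- `x` is a normal i-node: a removable i-node surviving (as a − sign) in the
reduced i-signature; equivalently, every window of the i-signature ending at `x`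
contains strictly more removable than addable i-nodes. -/
def Normal (h i : ℕ) (lam : BPartition) (x : ℕ × ℕ) : Prop :=
  Removable h i lam x ∧ ∀ z : ℕ × ℕ, posLE z x →
    Set.ncard {y | Addable h i lam y ∧ posLE z y ∧ posLE y x} <
      Set.ncard {y | Removable h i lam y ∧ posLE z y ∧ posLE y x}

/-- `x` is a conormal i-node: an addable i-node surviving (as a + sign) in the
reduced i-signature. -/
def Conormal (h i : ℕ) (lam : BPartition) (x : ℕ × ℕ) : Prop :=
  Addable h i lam x ∧ ∀ z : ℕ × ℕ, posLE x z →
    Set.ncard {y | Removable h i lam y ∧ posLE x y ∧ posLE y z} <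
      Set.ncard {y | Addable h i lam y ∧ posLE x y ∧ posLE y z}

/-- The node set of ψ_i(λ): add the leftmost s − r conormal i-nodes if s ≥ r,
remove the rightmost r − s normal i-nodes if r > s, where r = #normal and
s = #conormal i-nodes. -/
noncomputable def psiSet (h i : ℕ) (lam : BPartition) : Set (ℕ × ℕ) :=
  if Set.ncard {x | Normal h i lam x} ≤ Set.ncard {x | Conormal h i lam x} then
    diagram lam ∪ {x | Conormal h i lam x ∧
      Set.ncard {y | Conormal h i lam y ∧ posLE y x} ≤
        Set.ncard {x | Conormal h i lam x} - Set.ncard {x | Normal h i lam x}}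
  else
    diagram lam \ {x | Normal h i lam x ∧
      Set.ncard {y | Normal h i lam y ∧ posLE x y} ≤
        Set.ncard {x | Normal h i lam x} - Set.ncard {x | Conormal h i lam x}}

open Classical in
/-- The involution ψ_i. -/
noncomputable def psi (h i : ℕ) (lam : BPartition) : BPartition :=
  if hex : ∃ mu : BPartition, diagram mu = psiSet h i lam then hex.choose else lam

/-- The set of occupied positions of the abacus display of a strict partition. -/
def abacus (lam : BPartition) : Set ℤ :=
  {a | a = 0 ∨ (0 < a ∧ a.toNat ∈ partsM lam) ∨ (a < 0 ∧ (-a).toNat ∉ partsM lam)}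

/-- The dominance order: λ ⊴ μ. -/
def domLE (lam mu : BPartition) : Prop :=
  ∀ r, ∑ s ∈ Finset.range r, lam.parts s ≤ ∑ s ∈ Finset.range r, mu.parts s

/-- Strict dominance: λ ◁ μ. -/
def domLT (lam mu : BPartition) : Prop := domLE lam mu ∧ lam ≠ mu

/-- Lexicographic order: λ <lex μ. -/
def lexLT (lam mu : BPartition) : Prop :=
  ∃ r, lam.parts r < mu.parts r ∧ ∀ s < r, lam.parts s = mu.parts s

/-- Colexicographic order: λ <colex μ. -/
def colexLT (lam mu : BPartition) : Prop :=
  ∃ r, mu.parts r < lam.parts r ∧ ∀ s, r < s → lam.parts s = mu.parts s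

/-- λ ↔ᵢ μ: every node of the symmetric difference of the diagrams has residue i. -/
def Link (h i : ℕ) (lam mu : BPartition) : Prop :=
  ∀ x : ℕ × ℕ, x ∈ (diagram lam \ diagram mu) ∪ (diagram mu \ diagram lam) →
    colRes h x.2 = i

/-- `a ≤ b` are the bar positions of `lam ∈ P_{τ,2}`: the values recorded by
some two-step removal of h-bars from `lam` down to `tau`. -/
def BarPositions (h : ℕ) (tau lam : BPartition) (a b : ℕ) : Prop :=
  a ≤ b ∧ ∃ (nu : BPartition) (v₁ v₂ : ℕ), barStepRec h lam nu v₁ ∧ barStepRec h nu tau v₂ ∧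
    ({a, b} : Multiset ℕ) = {v₁, v₂}

/-- The leg length of the bar of `lam ∈ P_{τ,2}` at bar position `c`. -/
noncomputable def legLen (h : ℕ) (tau lam : BPartition) (c : ℕ) : ℕ :=
  if h ≤ c then Set.ncard {x : ℕ | c - h < x ∧ x < c ∧ x ∈ partsM lam ∧ x ∈ partsM tau}
  else (h - c) + Set.ncard {x : ℕ | h - c < x ∧ x < c ∧ x ∈ partsM lam ∧ x ∈ partsM tau}

/-- ∂λ: the absolute difference of the two leg lengths of `lam`, whose bar
positions are `a ≤ b`. -/
noncomputable def ddd (h : ℕ) (tau lam : BPartition) (a b : ℕ) : ℕ :=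
  max (legLen h tau lam a) (legLen h tau lam b) - min (legLen h tau lam a) (legLen h tau lam b)

inductive Colour | black | white | grey
deriving DecidableEq

/-- β(τ): the number of parts of τ less than h. -/
def betaCount (h : ℕ) (tau : BPartition) : ℕ :=
  Multiset.card ((partsM tau).filter (fun x => x < h))

/-- The leg length of a 2h-bar of `lam` with larger bar position `b`. -/
noncomputable def legLen2 (h : ℕ) (tau lam : BPartition) (b : ℕ) : ℕ :=
  if 2 * h ≤ b then Set.ncard {x : ℕ | b - 2 * h < x ∧ x < b ∧ x ∈ partsM lam ∧ x ∈ partsM tau}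
  else (2 * h - b) + Set.ncard {x : ℕ | 2 * h - b < x ∧ x < b ∧ x ∈ partsM lam ∧ x ∈ partsM tau}

/-- The colour of `lam ∈ P_{τ,2}` with bar positions `a ≤ b`. -/
noncomputable def colour (h : ℕ) (tau lam : BPartition) (a b : ℕ) : Colour :=
  if 2 ≤ ddd h tau lam a b then Colour.grey
  else if ddd h tau lam a b = 1 then
    if h < b then Colour.grey
    else if (min (legLen h tau lam a) (legLen h tau lam b) + betaCount h tau) % 2 = 1 then
      Colour.black else Colour.white
  else
    if b = a + h ∨ a + b = 2 * h then
      if (legLen2 h tau lam b + 2 * betaCount h tau) % 4 = 0 ∨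
         (legLen2 h tau lam b + 2 * betaCount h tau) % 4 = 3 then Colour.black
      else Colour.white
    else
      if (legLen h tau lam a + betaCount h tau) % 2 = 1 then Colour.black else Colour.white

end BPartition

namespace BPartition

theorem part_le (lam : BPartition) {r s : ℕ} (hrs : r ≤ s) : lam.parts s ≤ lam.parts r :=
  antitone_nat_of_succ_le lam.antitone hrs

theorem mem_pm (lam : BPartition) (x : ℕ) :
    x ∈ partsM lam ↔ x ≠ 0 ∧ ∃ r, lam.parts r = x := by
  unfold partsM
  rw [Multiset.mem_map]
  constructor
  · rintro ⟨r, hr, rfl⟩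
    exact ⟨by simpa using hr, r, rfl⟩
  · rintro ⟨h0, r, rfl⟩
    exact ⟨r, by simpa using h0, rfl⟩

theorem count_pm (lam : BPartition) (x : ℕ) :
    (partsM lam).count x = (lam.parts.support.filter (fun r => x = lam.parts r)).card := by
  unfold partsM
  rw [Multiset.count_map]
  rfl

theorem two_le_count (lam : BPartition) {r s : ℕ} (hrs : r ≠ s) (x : ℕ) (hx : x ≠ 0)
    (hr : lam.parts r = x) (hs : lam.parts s = x) : 2 ≤ (partsM lam).count x := by
  rw [count_pm]
  have : 1 < (lam.parts.support.filter (fun r => x = lam.parts r)).card := by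
    rw [Finset.one_lt_card]
    refine ⟨r, ?_, s, ?_, hrs⟩ <;> simp [hr, hs, hx]
  omega

theorem hs_iff (h : ℕ) (lam : BPartition) :
    IsHStrict h lam ↔ ∀ x, ¬ h ∣ x → (partsM lam).count x ≤ 1 := by
  constructor
  · intro H x hx
    rw [count_pm, Finset.card_le_one]
    have key : ∀ a b, a < b → lam.parts a = x → lam.parts b = x → False := by
      intro a b hab ha hb
      have h1 := part_le lam (Nat.succ_le_of_lt hab)
      have h2 := lam.antitone a
      rcases H a with h3 | h3 | h3
      · simp only [Nat.succ_eq_add_one] at h1; omega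
      · rw [ha] at h3; exact hx h3.2
      · rw [ha] at h3; subst h3; exact hx (dvd_zero h)
    intro a ha b hb
    simp only [Finset.mem_filter] at ha hb
    rcases lt_trichotomy a b with hl | hl | hl
    · exact (key a b hl ha.2.symm hb.2.symm).elim
    · exact hl
    · exact (key b a hl hb.2.symm ha.2.symm).elim
  · intro H r
    have h2 := lam.antitone r
    by_cases h0 : lam.parts r = 0
    · exact Or.inr (Or.inr h0)
    by_cases hd : h ∣ lam.parts r
    · exact Or.inr (Or.inl ⟨Nat.pos_of_ne_zero h0, hd⟩)
    left
    by_contra hlt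
    have := two_le_count lam (Nat.ne_of_lt (Nat.lt_succ_self r)) (lam.parts r) h0 rfl
      (by simp only [Nat.succ_eq_add_one]; omega)
    have := H _ hd
    omega

theorem exists_pm (M : Multiset ℕ) (h0 : 0 ∉ M) : ∃ lam : BPartition, partsM lam = M := by
  set l := M.sort (· ≥ ·) with hl
  have hlM : (l : Multiset ℕ) = M := Multiset.sort_eq _ _
  have hpos : ∀ i (hi : i < l.length), l[i] ≠ 0 := by
    intro i hi e
    apply h0
    rw [← hlM, ← e]
    exact List.getElem_mem hi
  have hsort : l.Pairwise (· ≥ ·) := Multiset.pairwise_sort _ _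
  let f : ℕ →₀ ℕ := Finsupp.onFinset (Finset.range l.length) (fun i => l.getD i 0) (by
    intro a ha
    rw [Finset.mem_range]
    by_contra hc
    exact ha (List.getD_eq_default _ _ (by omega)))
  have hf : ∀ i, f i = l.getD i 0 := fun i => rfl
  have hsupp : f.support = Finset.range l.length := by
    ext i
    rw [Finsupp.mem_support_iff, Finset.mem_range, hf]
    constructor
    · intro ha
      by_contra hc
      exact ha (List.getD_eq_default _ _ (by omega))
    · intro hi
      rw [List.getD_eq_getElem _ _ hi]
      exact hpos i hi
  refine ⟨⟨f, ?_⟩, ?_⟩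
  · intro r
    rw [hf, hf]
    by_cases hr : r + 1 < l.length
    · rw [List.getD_eq_getElem _ _ hr, List.getD_eq_getElem _ _ (by omega)]
      exact List.pairwise_iff_getElem.1 hsort r (r+1) (by omega) hr (by omega)
    · rw [List.getD_eq_default _ _ (by omega)]
      exact Nat.zero_le _
  · unfold partsM
    show f.support.val.map (fun r => f r) = M
    rw [hsupp, ← hlM]
    show Multiset.map (fun r => f r) (Multiset.range l.length) = _
    rw [← Multiset.coe_range, Multiset.map_coe, Multiset.coe_eq_coe]
    apply List.Perm.of_eq
    apply List.ext_getElem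
    · simp
    · intro i h1 h2
      simp [hf, h2]

def FF (k : ℕ) (M : Multiset ℕ) : ℕ := (M.map (fun x => x - k)).sum

theorem FF_cons (k a : ℕ) (M : Multiset ℕ) : FF k (a ::ₘ M) = (a - k) + FF k M := by
  simp [FF]

theorem FF_pm (k : ℕ) (lam : BPartition) :
    FF k (partsM lam) = ∑ s ∈ lam.parts.support, (lam.parts s - k) := by
  unfold FF partsM
  rw [Multiset.map_map]
  rfl

theorem dom_of_FF (lam mu : BPartition)
    (H : ∀ k, FF k (partsM lam) ≤ FF k (partsM mu)) : domLE lam mu := by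
  intro r
  have hk := H (mu.parts r)
  rw [FF_pm, FF_pm] at hk
  set k := mu.parts r with hkdef
  have h1 : ∑ s ∈ Finset.range r, (lam.parts s - k) ≤ ∑ s ∈ lam.parts.support, (lam.parts s - k) := by
    apply Finset.sum_le_sum_of_ne_zero
    intro x _ hx
    rw [Finsupp.mem_support_iff]
    omega
  have h2 : ∑ s ∈ mu.parts.support, (mu.parts s - k) ≤ ∑ s ∈ Finset.range r, (mu.parts s - k) := by
    apply Finset.sum_le_sum_of_ne_zero
    intro x _ hx
    rw [Finset.mem_range]
    by_contra hc
    have := part_le mu (show r ≤ x by omega)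
    omega
  have h3 : ∑ s ∈ Finset.range r, lam.parts s ≤ ∑ s ∈ Finset.range r, ((lam.parts s - k) + k) :=
    Finset.sum_le_sum (fun i _ => by omega)
  have h4 : ∑ s ∈ Finset.range r, ((mu.parts s - k) + k) = ∑ s ∈ Finset.range r, mu.parts s := by
    apply Finset.sum_congr rfl
    intro i hi
    rw [Finset.mem_range] at hi
    have := part_le mu hi.le
    omega
  rw [Finset.sum_add_distrib] at h3 h4
  omega

theorem pm_inj {lam mu : BPartition} (H : partsM lam = partsM mu) : lam = mu := by
  have h1 := dom_of_FF lam mu (fun k => by rw [H])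
  have h2 := dom_of_FF mu lam (fun k => by rw [H])
  have h3 : lam.parts = mu.parts := by
    ext r
    have e1 := le_antisymm (h1 r) (h2 r)
    have e2 := le_antisymm (h1 (r+1)) (h2 (r+1))
    rw [Finset.sum_range_succ, Finset.sum_range_succ] at e2
    omega
  cases lam; cases mu
  simp only at h3
  subst h3
  rfl

theorem restricted_of (h : ℕ) (lam : BPartition)
    (H : ∀ x ∈ partsM lam, h ≤ x → ∃ y ∈ partsM lam, y < x ∧ (x < y + h ∨ (x = y + h ∧ ¬ h ∣ x)))
    (hh : 0 < h) : IsRestricted h lam := by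
  intro r
  by_cases hx : lam.parts r < h
  · left; omega
  obtain ⟨y, hy, hlt, hor⟩ := H (lam.parts r) ((mem_pm _ _).2 ⟨by omega, r, rfl⟩) (by omega)
  obtain ⟨_, s, rfl⟩ := (mem_pm _ _).1 hy
  have hrs : r + 1 ≤ s := by
    by_contra hc
    have := part_le lam (show s ≤ r by omega)
    omega
  have := part_le lam hrs
  rcases hor with hor | ⟨hor, hd⟩
  · left; omega
  · by_cases e : lam.parts r < lam.parts (r+1) + h
    · exact Or.inl e
    · exact Or.inr ⟨by omega, hd⟩

/-- Facts about the multiset of parts of a core. -/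
structure BarCoreFacts (h : ℕ) (T : Multiset ℕ) : Prop where
  zero : 0 ∉ T
  nd : T.Nodup
  ndvd : ∀ x ∈ T, ¬ h ∣ x
  down : ∀ x ∈ T, h < x → x - h ∈ T
  pair : ∀ a b, a + b = h → a ∈ T → b ∉ T

theorem zero_notMem (lam : BPartition) : 0 ∉ partsM lam := by
  rw [mem_pm]; tauto

theorem core_facts (n h : ℕ) (hn : 1 ≤ n) (hh : h = 2 * n + 1) (tau : BPartition)
    (htau : IsBarCore h tau) : BarCoreFacts h (partsM tau) := by
  obtain ⟨hs, hc⟩ := htau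
  rw [hs_iff] at hs
  have h0 := zero_notMem tau
  have hnd : ∀ x ∈ partsM tau, ¬ h ∣ x := by
    intro x hx hd
    have hx0 : x ≠ 0 := fun e => h0 (e ▸ hx)
    have hle := Nat.le_of_dvd (by omega) hd
    rcases hle.eq_or_lt with e | hlt
    · obtain ⟨mu, hmu⟩ := exists_pm ((partsM tau).erase x)
        (fun hm => h0 (Multiset.mem_of_mem_erase hm))
      refine hc mu ⟨x, ?_, Or.inl ⟨e.symm, hx, hmu⟩⟩
      rw [hs_iff, hmu]
      intro y hy
      exact (Multiset.count_le_of_le _ (Multiset.erase_le _ _)).trans (hs y hy)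
    · obtain ⟨mu, hmu⟩ := exists_pm ((x - h) ::ₘ (partsM tau).erase x) (by
        rw [Multiset.mem_cons, not_or]
        exact ⟨by omega, fun hm => h0 (Multiset.mem_of_mem_erase hm)⟩)
      refine hc mu ⟨x, ?_, Or.inr (Or.inl ⟨hlt, hx, hmu⟩)⟩
      rw [hs_iff, hmu]
      intro y hy
      have hne : y ≠ x - h := by
        rintro rfl
        exact hy (Nat.dvd_sub hd dvd_rfl)
      rw [Multiset.count_cons_of_ne hne]
      exact (Multiset.count_le_of_le _ (Multiset.erase_le _ _)).trans (hs y hy)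
  have hnod : (partsM tau).Nodup := by
    rw [Multiset.nodup_iff_count_le_one]
    intro a
    by_cases ha : a ∈ partsM tau
    · exact hs a (hnd a ha)
    · rw [Multiset.count_eq_zero_of_notMem ha]; omega
  refine ⟨h0, hnod, hnd, ?_, ?_⟩
  · intro x hx hlt
    by_contra hm
    obtain ⟨mu, hmu⟩ := exists_pm ((x - h) ::ₘ (partsM tau).erase x) (by
        rw [Multiset.mem_cons, not_or]
        exact ⟨by omega, fun hm => h0 (Multiset.mem_of_mem_erase hm)⟩)
    refine hc mu ⟨x, ?_, Or.inr (Or.inl ⟨hlt, hx, hmu⟩)⟩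
    rw [hs_iff, hmu]
    intro y hy
    refine Multiset.nodup_iff_count_le_one.1 ?_ y
    rw [Multiset.nodup_cons]
    exact ⟨fun hm' => hm (Multiset.mem_of_mem_erase hm'), hnod.erase x⟩
  · intro a b hab ha hb
    have hne : b ≠ a := by omega
    have hb' : b ∈ (partsM tau).erase a := (Multiset.mem_erase_of_ne hne).2 hb
    obtain ⟨mu, hmu⟩ := exists_pm (((partsM tau).erase a).erase b)
        (fun hm => h0 (Multiset.mem_of_mem_erase (Multiset.mem_of_mem_erase hm)))
    refine hc mu ⟨max a b, ?_, Or.inr (Or.inr ⟨a, b, hab, ha, hb', rfl, hmu⟩)⟩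
    rw [hs_iff, hmu]
    intro y hy
    exact Multiset.nodup_iff_count_le_one.1 ((hnod.erase a).erase b) y

/-- Valid bar positions. -/
def VV (n h : ℕ) (T : Multiset ℕ) (v : ℕ) : Prop :=
  v = h ∨ (h < v ∧ v - h ∈ T ∧ v ∉ T) ∨ (n < v ∧ v < h ∧ v ∉ T ∧ h - v ∉ T)

/-- The parts of the partition with bar position `v`. -/
def MM (h : ℕ) (T : Multiset ℕ) (v : ℕ) : Multiset ℕ :=
  if h ≤ v then v ::ₘ T.erase (v - h) else v ::ₘ (h - v) ::ₘ T

theorem VV.notMem {n h : ℕ} {T : Multiset ℕ} {v : ℕ} (c : BarCoreFacts h T) (hv : VV n h T v) :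
    v ∉ T := by
  rcases hv with rfl | hv | hv
  · exact fun hm => c.ndvd _ hm dvd_rfl
  · exact hv.2.2
  · exact hv.2.2.1

theorem MM_zero {n h : ℕ} (hn : 1 ≤ n) (hh : h = 2 * n + 1) {T : Multiset ℕ} {v : ℕ}
    (c : BarCoreFacts h T) (hv : VV n h T v) : 0 ∉ MM h T v := by
  have hv0 : v ≠ 0 := by rcases hv with hv | hv | hv <;> omega
  unfold MM
  split_ifs with hle
  · rw [Multiset.mem_cons, not_or]
    exact ⟨by omega, fun hm => c.zero (Multiset.mem_of_mem_erase hm)⟩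
  · rw [Multiset.mem_cons, Multiset.mem_cons, not_or, not_or]
    exact ⟨by omega, by omega, c.zero⟩

theorem MM_nodup {n h : ℕ} (hn : 1 ≤ n) (hh : h = 2 * n + 1) {T : Multiset ℕ} {v : ℕ}
    (c : BarCoreFacts h T) (hv : VV n h T v) : (MM h T v).Nodup := by
  have hvT := hv.notMem c
  unfold MM
  split_ifs with hle
  · rw [Multiset.nodup_cons]
    exact ⟨fun hm => hvT (Multiset.mem_of_mem_erase hm), c.nd.erase _⟩
  · rcases hv with hv | hv | hv
    · omega
    · omega
    · rw [Multiset.nodup_cons, Multiset.nodup_cons, Multiset.mem_cons, not_or]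
      exact ⟨⟨by omega, hvT⟩, hv.2.2.2, c.nd⟩

theorem block_iff {n h : ℕ} (hn : 1 ≤ n) (hh : h = 2 * n + 1) (tau : BPartition)
    (htau : IsBarCore h tau) (lam : BPartition) :
    InBlock h tau 1 lam ↔ ∃ v, VV n h (partsM tau) v ∧ partsM lam = MM h (partsM tau) v := by
  have c := core_facts n h hn hh tau htau
  constructor
  · rintro ⟨hs, -, nu, ⟨v, hnu, hstep⟩, e⟩
    have e' : nu = tau := e
    subst e'
    rw [hs_iff] at hs
    have h0 := zero_notMem lam
    rcases hstep with ⟨rfl, hv, hT⟩ | ⟨hlt, hv, hT⟩ | ⟨a, b, hab, ha, hb, rfl, hT⟩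
    · refine ⟨v, Or.inl rfl, ?_⟩
      rw [MM, if_pos le_rfl, Nat.sub_self, Multiset.erase_of_notMem c.zero, hT,
        Multiset.cons_erase hv]
    · refine ⟨v, Or.inr (Or.inl ⟨hlt, by rw [hT]; exact Multiset.mem_cons_self _ _, ?_⟩), ?_⟩
      · intro hm
        have hd := c.ndvd v hm
        have h1 := hs v hd
        rw [hT, Multiset.mem_cons] at hm
        rcases hm with hm | hm
        · omega
        · rw [← Multiset.cons_erase hv, Multiset.count_cons_self] at h1
          have := Multiset.count_pos.2 hm
          omega
      · rw [MM, if_pos hlt.le, hT, Multiset.erase_cons_head, Multiset.cons_erase hv]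
    · have hL : partsM lam = a ::ₘ b ::ₘ partsM nu := by
        rw [hT, Multiset.cons_erase hb, Multiset.cons_erase ha]
      have ha0 : a ≠ 0 := fun e => h0 (e ▸ ha)
      have hb0 : b ≠ 0 := fun e => h0 (e ▸ Multiset.mem_of_mem_erase hb)
      have hnda : ¬ h ∣ a := fun hd => by have := Nat.le_of_dvd (by omega) hd; omega
      have hndb : ¬ h ∣ b := fun hd => by have := Nat.le_of_dvd (by omega) hd; omega
      have haT : a ∉ partsM nu := by
        intro hm
        have h1 := hs a hnda
        rw [hL, Multiset.count_cons_self] at h1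
        have := Multiset.count_pos.2 (Multiset.mem_cons_of_mem (b := b) hm)
        omega
      have hbT : b ∉ partsM nu := by
        intro hm
        have h1 := hs b hndb
        rw [hL, Multiset.cons_swap, Multiset.count_cons_self] at h1
        have := Multiset.count_pos.2 (Multiset.mem_cons_of_mem (b := a) hm)
        omega
      have hMM : ∀ v, v < h → MM h (partsM nu) v = v ::ₘ (h - v) ::ₘ partsM nu := by
        intro v hv
        rw [MM, if_neg (by omega)]
      rcases le_total a b with hle | hle
      · have e : h - b = a := by omega
        refine ⟨b, Or.inr (Or.inr ⟨by omega, by omega, hbT, by rwa [e]⟩), ?_⟩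
        rw [hMM b (by omega), e, hL, Multiset.cons_swap]
      · have e : h - a = b := by omega
        refine ⟨a, Or.inr (Or.inr ⟨by omega, by omega, haT, by rwa [e]⟩), ?_⟩
        rw [hMM a (by omega), e, hL]
  · rintro ⟨v, hv, hL⟩
    refine ⟨?_, htau, tau, ⟨v, htau.1, ?_⟩, rfl⟩
    · rw [hs_iff, hL]
      intro x _
      exact Multiset.nodup_iff_count_le_one.1 (MM_nodup hn hh c hv) x
    · rw [hL]
      rcases hv with rfl | hv | hv
      · left
        rw [MM, if_pos le_rfl, Nat.sub_self, Multiset.erase_of_notMem c.zero]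
        exact ⟨rfl, Multiset.mem_cons_self _ _, by rw [Multiset.erase_cons_head]⟩
      · right; left
        rw [MM, if_pos hv.1.le]
        refine ⟨hv.1, Multiset.mem_cons_self _ _, ?_⟩
        rw [Multiset.erase_cons_head, Multiset.cons_erase hv.2.1]
      · right; right
        rw [MM, if_neg (by omega)]
        refine ⟨v, h - v, by omega, Multiset.mem_cons_self _ _, ?_, by omega, ?_⟩
        · rw [Multiset.erase_cons_head]; exact Multiset.mem_cons_self _ _
        · rw [Multiset.erase_cons_head, Multiset.erase_cons_head]

theorem FF_MM {n h : ℕ} {T : Multiset ℕ} {v : ℕ} (c : BarCoreFacts h T) (hv : VV n h T v)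
    (hle : h ≤ v) (k : ℕ) : FF k (MM h T v) + (v - h - k) = (v - k) + FF k T := by
  rw [MM, if_pos hle, FF_cons]
  rcases hv with rfl | hv | hv
  · rw [Nat.sub_self, Multiset.erase_of_notMem c.zero]; omega
  · have := FF_cons k (v - h) (T.erase (v - h))
    rw [Multiset.cons_erase hv.2.1] at this
    omega
  · omega

theorem FF_mono {n h : ℕ} (hn : 1 ≤ n) (hh : h = 2 * n + 1) {T : Multiset ℕ} {v w : ℕ}
    (c : BarCoreFacts h T) (hv : VV n h T v) (hw : VV n h T w) (hlt : v ≤ w) (k : ℕ) :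
    FF k (MM h T v) ≤ FF k (MM h T w) := by
  have small : ∀ u, u < h → FF k (MM h T u) = (u - k) + ((h - u - k) + FF k T) := by
    intro u hu
    rw [MM, if_neg (by omega), FF_cons, FF_cons]
  by_cases h1 : h ≤ v
  · have e1 := FF_MM c hv h1 k
    have e2 := FF_MM c hw (h1.trans hlt) k
    omega
  · have e1 := small v (by omega)
    have hnv : n < v := by rcases hv with hv | hv | hv <;> omega
    by_cases h2 : h ≤ w
    · have e2 := FF_MM c hw h2 k
      omega
    · have e2 := small w (by omega)
      omega

theorem MM_inj {n h : ℕ} (hn : 1 ≤ n) (hh : h = 2 * n + 1) {T : Multiset ℕ} {v w : ℕ}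
    (c : BarCoreFacts h T) (hv : VV n h T v) (hw : VV n h T w) (hm : MM h T v = MM h T w) : v = w := by
  have hmem : v ∈ MM h T w := by
    rw [← hm, MM]; split_ifs <;> exact Multiset.mem_cons_self _ _
  have hvT := hv.notMem c
  have hnv : n < v := by rcases hv with hv | hv | hv <;> omega
  have hnw : n < w := by rcases hw with hv | hv | hv <;> omega
  rw [MM] at hmem
  split_ifs at hmem
  · rcases Multiset.mem_cons.1 hmem with e | e
    · exact e
    · exact (hvT (Multiset.mem_of_mem_erase e)).elim
  · rcases Multiset.mem_cons.1 hmem with e | e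
    · exact e
    · rcases Multiset.mem_cons.1 e with e | e
      · omega
      · exact (hvT e).elim

theorem BarCoreFacts.downs {h : ℕ} {T : Multiset ℕ} (c : BarCoreFacts h T) (k x : ℕ) (hx : 0 < x)
    (hm : x + k * h ∈ T) : x ∈ T := by
  induction k with
  | zero => simpa using hm
  | succ k ih =>
    apply ih
    have := c.down _ hm (by rw [Nat.add_mul]; omega)
    convert this using 1
    rw [Nat.add_mul]; omega

theorem BarCoreFacts.down_mod {h : ℕ} {T : Multiset ℕ} (c : BarCoreFacts h T) {x y : ℕ} (hx : 0 < x)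
    (hxy : x ≤ y) (hmod : x % h = y % h) (hm : y ∈ T) : x ∈ T := by
  obtain ⟨k, hk⟩ := (Nat.modEq_iff_dvd' hxy).1 hmod
  apply c.downs k x hx
  have : x + k * h = y := by rw [Nat.mul_comm k h]; omega
  rwa [this]

theorem BarCoreFacts.ext {n h : ℕ} (hh : 0 < h) {T : Multiset ℕ} (c : BarCoreFacts h T) {x : ℕ} (hx : x ∈ T) :
    ∃ v, VV n h T v ∧ x + h ≤ v ∧ v % h = x % h := by
  classical
  have hx0 : x ≠ 0 := fun e => c.zero (e ▸ hx)
  have hex : ∃ k, x + k * h ∉ T := by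
    refine ⟨T.sum + 1, fun hm => ?_⟩
    have h1 := Multiset.single_le_sum (fun _ _ => Nat.zero_le _) _ hm
    have h2 : T.sum + 1 ≤ (T.sum + 1) * h := Nat.le_mul_of_pos_right _ hh
    omega
  have hsp := Nat.find_spec hex
  have hmin := fun m => @Nat.find_min _ _ hex m
  set k := Nat.find hex
  obtain _ | j := k
  · simp at hsp; exact (hsp hx).elim
  · have hj := hmin j (by omega)
    rw [not_not] at hj
    have e : x + (j+1) * h = x + j * h + h := by ring
    refine ⟨x + (j+1) * h, Or.inr (Or.inl ⟨by rw [e]; omega, ?_, hsp⟩), by rw [e]; omega, by simp⟩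
    rw [e, Nat.add_sub_cancel]
    exact hj

theorem BarCoreFacts.mod_mem {h : ℕ} {T : Multiset ℕ} (c : BarCoreFacts h T) (hh : 0 < h) {x : ℕ} (hx : x ∈ T) :
    x % h ∈ T := by
  apply c.down_mod (y := x) _ (Nat.mod_le _ _) (Nat.mod_mod _ _) hx
  apply Nat.pos_of_ne_zero
  intro e
  exact c.ndvd x hx (Nat.dvd_of_mod_eq_zero e)

/-- The runner index. -/
def rho (n h v : ℕ) : ℕ := if v % h ≤ n then v % h else h - v % h

theorem VV_mod_inj {n h : ℕ} (hn : 1 ≤ n) (hh : h = 2 * n + 1) {T : Multiset ℕ} {v w : ℕ}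
    (c : BarCoreFacts h T) (hv : VV n h T v) (hw : VV n h T w) (hlt : v < w) : v % h ≠ w % h := by
  intro e
  obtain ⟨k, hk⟩ := (Nat.modEq_iff_dvd' hlt.le).1 e
  have hk0 : k ≠ 0 := by rintro rfl; simp at hk; omega
  have : h ≤ h * k := Nat.le_mul_of_pos_right _ (by omega)
  have hvpos : 0 < v := by rcases hv with hv | hv | hv <;> omega
  rcases hw with hw | hw | hw
  · omega
  · refine hv.notMem c (c.down_mod (y := w - h) hvpos (by omega) ?_ hw.2.1)
    rw [e]
    exact (Nat.mod_eq_sub_mod hw.1.le)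
  · omega

theorem VV_pair {n h : ℕ} (hn : 1 ≤ n) (hh : h = 2 * n + 1) {T : Multiset ℕ} {v w : ℕ}
    (c : BarCoreFacts h T) (hv : VV n h T v) (hw : VV n h T w) (hlt : v < w) : v % h + w % h ≠ h := by
  intro e
  have hlth := Nat.mod_lt v (show 0 < h by omega)
  have hlth' := Nat.mod_lt w (show 0 < h by omega)
  have big : ∀ u, h < u → u - h ∈ T → u % h ∈ T := by
    intro u hu hm
    rw [Nat.mod_eq_sub_mod hu.le]
    exact c.mod_mem (by omega) hm
  rcases hw with rfl | hw | hw
  · simp at e hlth; omega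
  · have h1 := big w hw.1 hw.2.1
    rcases hv with rfl | hv | hv
    · simp at e; omega
    · exact c.pair _ _ e (big v hv.1 hv.2.1) h1
    · rw [Nat.mod_eq_of_lt hv.2.1] at e
      apply hv.2.2.2
      have : h - v = w % h := by omega
      rwa [this]
  · rw [Nat.mod_eq_of_lt hw.2.1, Nat.mod_eq_of_lt (by omega)] at e
    rcases hv with hv | hv | hv <;> omega

theorem rho_lt {n h : ℕ} (hn : 1 ≤ n) (hh : h = 2 * n + 1) {T : Multiset ℕ} {v w : ℕ}
    (c : BarCoreFacts h T) (hv : VV n h T v) (hw : VV n h T w) (hlt : v < w) : rho n h v ≠ rho n h w := by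
  have h1 := VV_mod_inj hn hh c hv hw hlt
  have h2 := VV_pair hn hh c hv hw hlt
  have hlth := Nat.mod_lt v (show 0 < h by omega)
  have hlth' := Nat.mod_lt w (show 0 < h by omega)
  unfold rho
  split_ifs <;> omega

theorem VV_ncard {n h : ℕ} (hn : 1 ≤ n) (hh : h = 2 * n + 1) {T : Multiset ℕ}
    (c : BarCoreFacts h T) : Set.ncard {v | VV n h T v} = n + 1 := by
  have hinj : Set.InjOn (rho n h) {v | VV n h T v} := by
    intro v hv w hw e
    rcases lt_trichotomy v w with hl | hl | hl
    · exact (rho_lt hn hh c hv hw hl e).elim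
    · exact hl
    · exact (rho_lt hn hh c hw hv hl e.symm).elim
  rw [← Set.ncard_image_of_injOn hinj]
  have himg : rho n h '' {v | VV n h T v} = ((Finset.range (n+1) : Finset ℕ) : Set ℕ) := by
    ext i
    simp only [Set.mem_image, Set.mem_setOf_eq, Finset.coe_range, Set.mem_Iio]
    constructor
    · rintro ⟨v, _, rfl⟩
      have hlth := Nat.mod_lt v (show 0 < h by omega)
      unfold rho
      split_ifs <;> omega
    · intro hi
      by_cases hi0 : i = 0
      · exact ⟨h, Or.inl rfl, by simp [rho, hi0]⟩
      by_cases h1 : i ∈ T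
      · obtain ⟨v, hv, -, hm⟩ := c.ext (n := n) (by omega) h1
        refine ⟨v, hv, ?_⟩
        rw [rho, hm, Nat.mod_eq_of_lt (by omega), if_pos (by omega)]
      by_cases h2 : h - i ∈ T
      · obtain ⟨v, hv, -, hm⟩ := c.ext (n := n) (by omega) h2
        refine ⟨v, hv, ?_⟩
        rw [rho, hm, Nat.mod_eq_of_lt (by omega), if_neg (by omega)]
        omega
      · refine ⟨h - i, Or.inr (Or.inr ⟨by omega, by omega, h2, ?_⟩), ?_⟩
        · have : h - (h - i) = i := by omega
          rwa [this]
        · rw [rho, Nat.mod_eq_of_lt (by omega), if_neg (by omega)]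
          omega
  rw [himg, Set.ncard_coe_finset, Finset.card_range]

theorem MM_restricted {n h : ℕ} (hn : 1 ≤ n) (hh : h = 2 * n + 1) {T : Multiset ℕ} {v w : ℕ}
    (c : BarCoreFacts h T) (hv : VV n h T v) (hw : VV n h T w) (hlt : v < w) (hhw : h ≤ w)
    (lam : BPartition) (hL : partsM lam = MM h T v) : IsRestricted h lam := by
  apply restricted_of h lam _ (by omega)
  rw [hL]
  have hvT := hv.notMem c
  by_cases hle : h ≤ v
  · have hw' : h < w ∧ w - h ∈ T ∧ w ∉ T := by
      rcases hw with hw | hw | hw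
      · omega
      · exact hw
      · omega
    have hMM : MM h T v = v ::ₘ T.erase (v - h) := by rw [MM, if_pos hle]
    rw [hMM]
    have hmem : ∀ y ∈ T, y ≠ v - h → y ∈ v ::ₘ T.erase (v - h) := fun y hy hne =>
      Multiset.mem_cons_of_mem ((Multiset.mem_erase_of_ne hne).2 hy)
    intro x hx hxh
    rcases Multiset.mem_cons.1 hx with rfl | hx
    · -- the new part
      have hwd : w % h ≠ 0 := by
        intro e
        rw [Nat.mod_eq_sub_mod hw'.1.le] at e
        exact c.ndvd _ hw'.2.1 (Nat.dvd_of_mod_eq_zero e)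
      have hne := VV_mod_inj hn hh c hv hw hlt
      have hlth := Nat.mod_lt (w - (x - h)) (show 0 < h by omega)
      set d := (w - (x - h)) % h with hd
      have hyw : (x - h + d) % h = w % h := by
        rw [hd, Nat.add_mod_mod]
        congr 1; omega
      have hd0 : d ≠ 0 := by
        intro e
        rw [e, Nat.add_zero, ← Nat.mod_eq_sub_mod hle] at hyw
        exact hne hyw
      have hyle : x - h + d ≤ w - h := by
        by_contra hc
        have hylt : x - h + d < w := by omega
        obtain ⟨k, hk⟩ := (Nat.modEq_iff_dvd' hylt.le).1 hyw
        have hk0 : k ≠ 0 := by rintro rfl; simp at hk; omega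
        have : h ≤ h * k := Nat.le_mul_of_pos_right _ (by omega)
        omega
      have hyT : x - h + d ∈ T := by
        apply c.down_mod (y := w - h) (by omega) hyle _ hw'.2.1
        rw [hyw, Nat.mod_eq_sub_mod hw'.1.le]
      exact ⟨x - h + d, hmem _ hyT (by omega), by omega, Or.inl (by omega)⟩
    · have hxT := Multiset.mem_of_mem_erase hx
      have hxd := c.ndvd x hxT
      have hxne : x ≠ h := by rintro rfl; exact hxd dvd_rfl
      have hxv : x ≠ v := by rintro rfl; exact hvT hxT
      exact ⟨x - h, hmem _ (c.down x hxT (by omega)) (by omega), by omega,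
        Or.inr ⟨by omega, hxd⟩⟩
  · have hMM : MM h T v = v ::ₘ (h - v) ::ₘ T := by rw [MM, if_neg hle]
    rw [hMM]
    intro x hx hxh
    rcases Multiset.mem_cons.1 hx with rfl | hx
    · omega
    rcases Multiset.mem_cons.1 hx with rfl | hxT
    · rcases hv with hv | hv | hv <;> omega
    have hxd := c.ndvd x hxT
    have hxne : x ≠ h := by rintro rfl; exact hxd dvd_rfl
    exact ⟨x - h, Multiset.mem_cons_of_mem (Multiset.mem_cons_of_mem (c.down x hxT (by omega))),
      by omega, Or.inr ⟨by omega, hxd⟩⟩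

theorem MM_top {n h : ℕ} (hn : 1 ≤ n) (hh : h = 2 * n + 1) {T : Multiset ℕ} {v : ℕ}
    (c : BarCoreFacts h T) (hv : VV n h T v) (hmax : ∀ w, VV n h T w → w ≤ v)
    (lam : BPartition) (hL : partsM lam = MM h T v) : ¬ IsRestricted h lam := by
  have hhv : h ≤ v := hmax h (Or.inl rfl)
  have hT : ∀ x ∈ T, x + h ≤ v := by
    intro x hx
    obtain ⟨w, hw, hle, -⟩ := c.ext (n := n) (by omega) hx
    exact hle.trans (hmax w hw)
  have hnod := MM_nodup hn hh c hv
  rw [← hL] at hnod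
  have hMM : MM h T v = v ::ₘ T.erase (v - h) := by rw [MM, if_pos hhv]
  rw [hMM] at hL
  have hmem : ∀ r, lam.parts r ≠ 0 → lam.parts r = v ∨ lam.parts r ∈ T.erase (v - h) := by
    intro r hr
    rw [← Multiset.mem_cons, ← hL]
    exact (mem_pm _ _).2 ⟨hr, r, rfl⟩
  have hvm : v ∈ partsM lam := by rw [hL]; exact Multiset.mem_cons_self _ _
  obtain ⟨_, r, hr⟩ := (mem_pm _ _).1 hvm
  have h0r := part_le lam (Nat.zero_le r)
  have h0 : lam.parts 0 = v := by
    rcases hmem 0 (by omega) with e | e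
    · exact e
    · have := hT _ (Multiset.mem_of_mem_erase e); omega
  intro hres
  have h1 := hres 0
  rw [h0, Nat.zero_add] at h1
  by_cases hz : lam.parts 1 = 0
  · rcases h1 with h1 | ⟨h1, hd⟩
    · omega
    · exact hd ⟨1, by omega⟩
  · rcases hmem 1 hz with e | e
    · have h2 := two_le_count lam (show (0:ℕ) ≠ 1 by omega) v (by omega) h0 e
      have h3 := Multiset.nodup_iff_count_le_one.1 hnod v
      omega
    · have h2 := hT _ (Multiset.mem_of_mem_erase e)
      have h3 : lam.parts 1 ≠ v - h := fun e' => by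
        rw [e'] at e
        exact c.nd.notMem_erase e
      omega

end BPartition

open BPartition in
/-- P_{τ,1} has exactly n+1 elements, totally ordered by dominance, all restricted
except the most dominant one, which is not restricted. -/
theorem stmt5 (n h : ℕ) (hn : 1 ≤ n) (hh : h = 2 * n + 1)
    (tau : BPartition) (htau : IsBarCore h tau) :
    Set.ncard {lam | InBlock h tau 1 lam} = n + 1 ∧
    (∀ lam mu, InBlock h tau 1 lam → InBlock h tau 1 mu → domLE lam mu ∨ domLE mu lam) ∧
    ∃ top, InBlock h tau 1 top ∧ (∀ lam, InBlock h tau 1 lam → domLE lam top) ∧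
      ¬ IsRestricted h top ∧
      ∀ lam, InBlock h tau 1 lam → lam ≠ top → IsRestricted h lam := by
  have c := core_facts n h hn hh tau htau
  have hb := block_iff hn hh tau htau
  have hcard := VV_ncard hn hh c
  have hex : ∀ v, VV n h (partsM tau) v → ∃ lam, partsM lam = MM h (partsM tau) v :=
    fun v hv => exists_pm _ (MM_zero hn hh c hv)
  refine ⟨?_, ?_, ?_⟩
  · rw [← hcard]
    choose g hg using hex
    symm
    refine Set.ncard_congr (fun v hv => g v hv) ?_ ?_ ?_
    · intro v hv
      exact (hb _).2 ⟨v, hv, hg v hv⟩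
    · intro v w hv hw e
      apply MM_inj hn hh c hv hw
      rw [← hg v hv, ← hg w hw, e]
    · intro lam hlam
      obtain ⟨v, hv, hL⟩ := (hb _).1 hlam
      exact ⟨v, hv, pm_inj (by rw [hg v hv, hL])⟩
  · intro lam mu hlam hmu
    obtain ⟨v, hv, hL⟩ := (hb _).1 hlam
    obtain ⟨w, hw, hM⟩ := (hb _).1 hmu
    rcases le_total v w with hl | hl
    · left
      apply dom_of_FF
      rw [hL, hM]
      exact FF_mono hn hh c hv hw hl
    · right
      apply dom_of_FF
      rw [hL, hM]
      exact FF_mono hn hh c hw hv hl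
  · have hfin : {v | VV n h (partsM tau) v}.Finite :=
      Set.finite_of_ncard_ne_zero (by omega)
    obtain ⟨v, hv, hmax⟩ := Set.exists_max_image _ id hfin ⟨h, Or.inl rfl⟩
    have hmax' : ∀ w, VV n h (partsM tau) w → w ≤ v := hmax
    obtain ⟨top, htop⟩ := hex v hv
    refine ⟨top, (hb _).2 ⟨v, hv, htop⟩, ?_, MM_top hn hh c hv hmax' top htop, ?_⟩
    · intro lam hlam
      obtain ⟨w, hw, hL⟩ := (hb _).1 hlam
      apply dom_of_FF
      rw [hL, htop]
      exact FF_mono hn hh c hw hv (hmax' w hw)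
    · intro lam hlam hne
      obtain ⟨w, hw, hL⟩ := (hb _).1 hlam
      have hwv : w ≠ v := by
        rintro rfl
        exact hne (pm_inj (by rw [hL, htop]))
      have := hmax' w hw
      exact MM_restricted hn hh c hw hv (by omega) (hmax' h (Or.inl rfl)) lam hL
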